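/- Define γ : ℤ × ℕ → ℤ by γ(n,0) = n and γ(n,m+1) = Σ_{l=0}^{m} γ(n,m−l)·(γ(n−1,l) + γ(n,l) + γ(n+1,l)), and let p_m be the integer polynomial of degree m+1 with γ(n,m) = p_m(n) for all n ∈ ℤ. Then for every m ≥ 1, the coefficient of X^{m−1} in p_m equals 3^{m−1}·C_m^{(1)}, where C^{(1)} are the torus coefficients (for example γ(n,2) = 18n^3 + 6n and 6 = 3·C_2^{(1)}). -/

import Mathlib

open Polynomial Finset

theorem coeff_mul_add_add_two_of_natDegree_le {R : Type*} [Semiring R] {p q : R[X]} {m n : ℕ}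
    (hp : p.natDegree ≤ m + 2) (hq : q.natDegree ≤ n + 2) :
    (p * q).coeff (m + n + 2) = p.coeff m * q.coeff (n + 2) +
      p.coeff (m + 1) * q.coeff (n + 1) + p.coeff (m + 2) * q.coeff n := by
  rw [coeff_mul, ← Finset.sum_subset
    (s₁ := {(m, n + 2), (m + 1, n + 1), (m + 2, n)})]
  · rw [Finset.sum_insert (by simp), Finset.sum_insert (by simp), Finset.sum_singleton, add_assoc]
  · intro x hx
    simp only [mem_insert, mem_singleton] at hx
    rw [HasAntidiagonal.mem_antidiagonal]
    rcases hx with rfl | rfl | rfl <;> dsimp only <;> omega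
  · rintro ⟨i, j⟩ hij hnot
    simp only [HasAntidiagonal.mem_antidiagonal, mem_insert, mem_singleton, Prod.mk.injEq,
      not_or] at hij hnot
    rcases lt_or_ge (m + 2) i with hi | hi
    · simp [coeff_eq_zero_of_natDegree_lt (hp.trans_lt hi)]
    · simp [coeff_eq_zero_of_natDegree_lt (p := q) (n := j) (hq.trans_lt (by omega))]

theorem coeff_taylor_eq_sum_of_natDegree_lt {R : Type*} [CommSemiring R] {p : R[X]} {N : ℕ}
    (hp : p.natDegree < N) (r : R) (k : ℕ) :
    (taylor r p).coeff k = ∑ i ∈ range N, (i.choose k : R) * p.coeff i * r ^ (i - k) := by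
  rw [taylor_coeff, hasseDeriv_apply, sum_over_range' _ (by simp) N hp, eval_finsetSum]
  simp [eval_monomial]

/-- `p = a X ^ (m + 1) + b X ^ (m - 1) + O(X ^ (m - 2))`, with `b = 0` when `m = 0`. -/
structure HasTopCoeffs (m : ℕ) (p : ℤ[X]) (a b : ℤ) : Prop where
  natDegree_le : p.natDegree ≤ m + 1
  coeff_top : p.coeff (m + 1) = a
  coeff_middle : p.coeff m = 0
  coeff_bottom : (X * p).coeff m = b

namespace HasTopCoeffs

theorem mul {m n : ℕ} {p q : ℤ[X]} {a b c d : ℤ} (hp : HasTopCoeffs m p a b)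
    (hq : HasTopCoeffs n q c d) :
    HasTopCoeffs (m + n + 1) (p * q) (a * c) (a * d + b * c) := by
  have hXp : (X * p).natDegree ≤ m + 2 :=
    natDegree_mul_le.trans (by have := natDegree_X_le (R := ℤ); have := hp.natDegree_le; omega)
  have hXq : (X * q).natDegree ≤ n + 2 :=
    natDegree_mul_le.trans (by have := natDegree_X_le (R := ℤ); have := hq.natDegree_le; omega)
  refine ⟨natDegree_mul_le.trans ?_, ?_, ?_, ?_⟩
  · have := hp.natDegree_le
    have := hq.natDegree_le
    omega
  · rw [show m + n + 1 + 1 = (m + 1) + (n + 1) by ring,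
      coeff_mul_add_eq_of_natDegree_le hp.natDegree_le hq.natDegree_le, hp.coeff_top, hq.coeff_top]
  · have h := coeff_mul_add_add_two_of_natDegree_le (m := m) (n := n + 1) hXp
      (hXq.trans (Nat.le_succ _))
    rw [show X * p * (X * q) = X * (X * (p * q)) by ring] at h
    rw [show m + (n + 1) + 2 = m + n + 1 + 1 + 1 by ring] at h
    simp only [coeff_X_mul] at h
    rw [h, coeff_eq_zero_of_natDegree_lt (p := q) (n := n + 1 + 1)
      (hq.natDegree_le.trans_lt (Nat.lt_succ_self _)), hp.coeff_middle, hq.coeff_middle]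
    ring
  · have h := coeff_mul_add_add_two_of_natDegree_le hXp hXq
    rw [show X * p * (X * q) = X * (X * (p * q)) by ring] at h
    simp only [coeff_X_mul] at h
    rw [coeff_X_mul, h, hp.coeff_bottom, hq.coeff_bottom, hp.coeff_middle, hp.coeff_top,
      hq.coeff_top]
    ring

theorem sum {ι : Type*} (s : Finset ι) {m : ℕ} {p : ι → ℤ[X]} {a b : ι → ℤ}
    (h : ∀ i ∈ s, HasTopCoeffs m (p i) (a i) (b i)) :
    HasTopCoeffs m (∑ i ∈ s, p i) (∑ i ∈ s, a i) (∑ i ∈ s, b i) where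
  natDegree_le := natDegree_sum_le_of_forall_le s p fun i hi => (h i hi).natDegree_le
  coeff_top := by
    rw [finsetSum_coeff]; exact Finset.sum_congr rfl fun i hi => (h i hi).coeff_top
  coeff_middle := by
    rw [finsetSum_coeff]; exact Finset.sum_eq_zero fun i hi => (h i hi).coeff_middle
  coeff_bottom := by
    rw [Finset.mul_sum, finsetSum_coeff]
    exact Finset.sum_congr rfl fun i hi => (h i hi).coeff_bottom

theorem taylor_add_taylor {m : ℕ} {p : ℤ[X]} {a b : ℤ} (h : HasTopCoeffs m p a b) :
    HasTopCoeffs m (taylor (-1) p + p + taylor 1 p) (3 * a) (3 * b + m * (m + 1) * a) := by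
  have hN : p.natDegree < m + 2 := h.natDegree_le.trans_lt (Nat.lt_succ_self _)
  obtain ⟨hd, ha, hm, hb⟩ := h
  have vanish : ∀ (r : ℤ) (k : ℕ), m ≤ k →
      ∑ i ∈ range m, (i.choose k : ℤ) * p.coeff i * r ^ (i - k) = 0 := fun r k hk =>
    Finset.sum_eq_zero fun i hi => by
      rw [Nat.choose_eq_zero_of_lt (by have := mem_range.1 hi; omega)]; simp
  refine ⟨?_, ?_, ?_, ?_⟩
  · refine natDegree_add_le_of_degree_le (natDegree_add_le_of_degree_le ?_ hd) ?_ <;>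
      rwa [natDegree_taylor]
  · simp only [coeff_add, coeff_taylor_eq_sum_of_natDegree_lt hN, Finset.sum_range_succ]
    rw [vanish _ _ (by omega), vanish _ _ (by omega)]
    simp [ha]
    ring
  · simp only [coeff_add, coeff_taylor_eq_sum_of_natDegree_lt hN, Finset.sum_range_succ]
    rw [vanish _ _ (by omega), vanish _ _ (by omega)]
    simp [ha, hm]
  · rcases m with _ | k
    · simp only [mul_coeff_zero, coeff_X_zero, zero_mul] at hb ⊢
      simp [← hb]
    · rw [coeff_X_mul] at hb ⊢
      simp only [coeff_add, coeff_taylor_eq_sum_of_natDegree_lt hN, Finset.sum_range_succ]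
      have vanish' : ∀ r : ℤ,
          ∑ i ∈ range k, (i.choose k : ℤ) * p.coeff i * r ^ (i - k) = 0 := fun r =>
        Finset.sum_eq_zero fun i hi => by
          rw [Nat.choose_eq_zero_of_lt (mem_range.1 hi)]; simp
      have hc : ((k + 1 + 1).choose k : ℤ) * 2 = (k + 1) * (k + 2) := by
        have h2 := Nat.choose_symm_add (a := k) (b := 2)
        have h3 := Nat.triangle_succ (k + 1)
        have h4 := Nat.choose_two_right (k + 2)
        have h5 := Nat.div_mul_cancel (Nat.even_mul_pred_self (k + 2)).two_dvd
        rw [← h4, ← h2] at h5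
        simp only [show k + 2 - 1 = k + 1 by omega] at h5
        rw [mul_comm ((k : ℤ) + 1)]
        exact_mod_cast h5
      rw [vanish', vanish']
      simp only [hm, ha, hb, show k + 1 + 1 - k = 2 by omega, Nat.choose_self]
      push_cast
      simp only [Nat.sub_self, pow_zero]
      linear_combination a * hc

end HasTopCoeffs

/-- The subleading (torus) coefficient of the polynomial `pₘ` representing the Taylor
coefficients `γ(n,m)` of the quartic matrix model equals `3^{m-1}·Cₘ⁽¹⁾`, where
`C⁽¹⁾` are the torus coefficients. -/
theorem quartic_taylor_torus_coefficient (γ : ℤ → ℕ → ℤ)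
    (h0 : ∀ n : ℤ, γ n 0 = n)
    (hrec : ∀ (n : ℤ) (m : ℕ), γ n (m + 1) =
        ∑ l ∈ Finset.range (m + 1),
          γ n (m - l) * (γ (n - 1) l + γ n l + γ (n + 1) l))
    (C1 : ℕ → ℤ)
    (hC10 : C1 0 = 0)
    (hC1rec : ∀ m : ℕ, C1 (m + 1) =
        2 * ∑ k ∈ Finset.range (m + 1), (catalan (m - k) : ℤ) * C1 k
          + ∑ k ∈ Finset.range (m + 1),
              (k : ℤ) * ((k : ℤ) + 1) * (catalan (m - k) : ℤ) * (catalan k : ℤ)) :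
    ∀ m : ℕ, 1 ≤ m → ∀ p : Polynomial ℤ,
      (∀ n : ℤ, γ n m = p.eval n) →
      p.coeff (m - 1) = 3 ^ (m - 1) * C1 m := by
  have key : ∀ m : ℕ, ∃ p : ℤ[X], ∃ b : ℤ, (∀ n : ℤ, γ n m = p.eval n) ∧
      HasTopCoeffs m p (3 ^ m * catalan m) b ∧ 3 * b = 3 ^ m * C1 m := by
    intro m
    induction m using Nat.strong_induction_on with
    | _ m ih =>
      rcases m with _ | m
      · exact ⟨X, 0, by simp [h0], ⟨by simp, by simp, by simp, by simp⟩, by simp [hC10]⟩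
      · choose! P b hP hPb hb using ih
        refine ⟨∑ l ∈ range (m + 1), P (m - l) * (taylor (-1) (P l) + P l + taylor 1 (P l)),
          ∑ l ∈ range (m + 1), (3 ^ (m - l) * catalan (m - l) *
            (3 * b l + l * (l + 1) * (3 ^ l * catalan l)) +
            b (m - l) * (3 * (3 ^ l * catalan l))), fun n => ?_, ?_, ?_⟩
        · rw [hrec, eval_finsetSum]
          refine Finset.sum_congr rfl fun l hl => ?_
          have hl' := mem_range.1 hl
          rw [hP _ (by omega), hP _ hl', hP _ hl', hP _ hl']
          simp [taylor_eval, sub_eq_add_neg, add_comm]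
        · have hsum := HasTopCoeffs.sum (range (m + 1)) (m := m + 1)
            (p := fun l => P (m - l) * (taylor (-1) (P l) + P l + taylor 1 (P l)))
            (a := fun l => 3 ^ (m - l) * catalan (m - l) * (3 * (3 ^ l * catalan l)))
            (b := fun l => 3 ^ (m - l) * catalan (m - l) *
              (3 * b l + l * (l + 1) * (3 ^ l * catalan l)) +
              b (m - l) * (3 * (3 ^ l * catalan l))) fun l hl => by
              have hl' := mem_range.1 hl
              have := (hPb (m - l) (by omega)).mul (hPb l hl').taylor_add_taylor
              rwa [show m - l + l + 1 = m + 1 by omega] at this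
          convert hsum using 1
          rw [catalan_succ', Finset.Nat.sum_antidiagonal_eq_sum_range_succ
            (fun i j => catalan i * catalan j)]
          push_cast
          rw [Finset.mul_sum]
          refine Finset.sum_congr rfl fun l hl => ?_
          have h3 : (3 : ℤ) ^ (m - l) * 3 ^ l = 3 ^ m := by
            rw [← pow_add, Nat.sub_add_cancel (by have := mem_range.1 hl; omega)]
          rw [pow_succ]
          linear_combination -(3 * catalan l * catalan (m - l) : ℤ) * h3
        · have hflip : ∑ l ∈ range (m + 1), b (m - l) * (3 * (3 ^ l * (catalan l : ℤ))) =
              ∑ l ∈ range (m + 1), b l * (3 * (3 ^ (m - l) * (catalan (m - l) : ℤ))) := by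
            rw [← Finset.sum_range_reflect]
            refine Finset.sum_congr rfl fun l hl => ?_
            have hl' := mem_range.1 hl
            rw [show m - (m + 1 - 1 - l) = l by omega, show m + 1 - 1 - l = m - l by omega]
          rw [Finset.sum_add_distrib, hflip, ← Finset.sum_add_distrib, hC1rec, Finset.mul_sum,
            Finset.mul_sum, ← Finset.sum_add_distrib, Finset.mul_sum]
          refine Finset.sum_congr rfl fun l hl => ?_
          have hl' := mem_range.1 hl
          have h3 : (3 : ℤ) ^ (m - l) * 3 ^ l = 3 ^ m := by
            rw [← pow_add, Nat.sub_add_cancel (by omega)]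
          rw [pow_succ, ← h3]
          linear_combination (6 * 3 ^ (m - l) * catalan (m - l) : ℤ) * hb l hl'
  rintro (_ | m) hm p hp
  · omega
  obtain ⟨q, b, hq, hqb, hb⟩ := key (m + 1)
  obtain rfl : p = q := Polynomial.funext fun n => by rw [← hp, hq]
  rw [Nat.add_sub_cancel, ← coeff_X_mul, hqb.coeff_bottom]
  rw [pow_succ] at hb
  linarith
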